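/- Let G ∈ ℕ, ε > 0, and set d' = ε/(2+ε). Let q ∈ (0,1) be such that q ≤ d'/8 and G·q ≥ 8/d', and let f(y) = C(G,y)·q^y·(1−q)^{G−y} denote the binomial probability mass function with parameters G and q. Then for every natural number y satisfying (1−d')·G·q ≤ y ≤ (1+d')·G·q, one has both f(y+1) ≤ e^{ε}·f(y) and f(y) ≤ e^{ε}·f(y+1). -/

import Mathlib

/-- The probability mass function of a binomial random variable with `G` trials
and success probability `q`. -/
noncomputable def binomialPMF (G : ℕ) (q : ℝ) (y : ℕ) : ℝ :=
  (G.choose y : ℝ) * q ^ y * (1 - q) ^ (G - y)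

/-- Consecutive values of the binomial mass function share a common nonnegative factor. -/
theorem binomialPMF_exists_common_factor {G y : ℕ} (hy : y < G) {q : ℝ} (hq0 : 0 ≤ q)
    (hq1 : q ≤ 1) :
    ∃ A : ℝ, 0 ≤ A ∧ binomialPMF G q y = A * ((y + 1) * (1 - q)) ∧
      binomialPMF G q (y + 1) = A * ((G - y) * q) := by
  have hq' : 0 ≤ 1 - q := sub_nonneg.2 hq1
  have hy' : (y : ℝ) + 1 ≠ 0 := by positivity
  have hchoose : (G.choose (y + 1) : ℝ) * (y + 1) = G.choose y * (G - y) := by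
    have h := Nat.choose_succ_right_eq G y
    rw [← Nat.cast_sub hy.le]
    exact_mod_cast h
  refine ⟨G.choose y * q ^ y * (1 - q) ^ (G - (y + 1)) / (y + 1), by positivity, ?_, ?_⟩
  · rw [binomialPMF, show G - y = G - (y + 1) + 1 by omega, pow_succ]
    field_simp
  · rw [binomialPMF, eq_div_of_mul_eq hy' hchoose, pow_succ]
    field_simp

/-- Single-variable version of Equation (2) (Appendix B.3): with
`d' = ε/(2+ε)`, if `q ≤ d'/8` and `G·q ≥ 8/d'`, then for every `y` in the
central interval `[(1−d')·G·q, (1+d')·G·q]`, the binomial PMF `f` with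
parameters `G` and `q` satisfies `f(y+1) ≤ e^ε·f(y)` and `f(y) ≤ e^ε·f(y+1)`. -/
theorem binomial_pmf_shift_bounded (G : ℕ) (ε : ℝ) (hε : 0 < ε)
    (q : ℝ) (hq0 : 0 < q) (hq1 : q < 1)
    (hq : q ≤ (ε / (2 + ε)) / 8)
    (hGq : 8 / (ε / (2 + ε)) ≤ (G : ℝ) * q)
    (y : ℕ)
    (hy1 : (1 - ε / (2 + ε)) * ((G : ℝ) * q) ≤ (y : ℝ))
    (hy2 : (y : ℝ) ≤ (1 + ε / (2 + ε)) * ((G : ℝ) * q)) :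
    binomialPMF G q (y + 1) ≤ Real.exp ε * binomialPMF G q y ∧
      binomialPMF G q y ≤ Real.exp ε * binomialPMF G q (y + 1) := by
  have hE : 1 + ε ≤ Real.exp ε := by linarith [Real.add_one_le_exp ε]
  have hεd : (1 + ε) * (1 - ε / (2 + ε)) = 1 + ε / (2 + ε) := by
    field_simp
    ring
  have hd0 : 0 < ε / (2 + ε) := by positivity
  have hd1 : ε / (2 + ε) < 1 := by rw [div_lt_one (by positivity)]; linarith
  generalize ε / (2 + ε) = d at *
  have hM : 8 ≤ G * q * d := (div_le_iff₀ hd0).1 hGq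
  have hM0 : 0 < G * q := lt_of_lt_of_le (by positivity) hGq
  have hG : (0 : ℝ) < G := pos_of_mul_pos_left hM0 hq0.le
  have hq8 : q ≤ 1 / 8 := by linarith
  have hyG : (y : ℝ) < G := by nlinarith
  obtain ⟨A, hA, h₀, h₁⟩ :=
    binomialPMF_exists_common_factor (Nat.cast_lt.1 hyG) hq0.le hq1.le
  have hup : (G - y) * q ≤ (1 + ε) * ((y + 1) * (1 - q)) := by
    have hleft : (G - y) * q ≤ G * q * (1 - q + d * q) := by
      linarith [mul_le_mul_of_nonneg_right hy1 hq0.le]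
    have hmid : G * q * (1 - q + d * q) ≤ G * q * ((1 + d) * (1 - q)) := by
      gcongr
      nlinarith
    have hright : G * q * ((1 + d) * (1 - q)) ≤ (1 + ε) * ((y + 1) * (1 - q)) := by
      rw [← hεd]
      calc G * q * ((1 + ε) * (1 - d) * (1 - q))
          = (1 + ε) * (((1 - d) * (G * q)) * (1 - q)) := by ring
        _ ≤ (1 + ε) * ((y + 1) * (1 - q)) := by
          have : 0 ≤ 1 - q := by linarith
          gcongr
          linarith
    linarith
  have hdown : (y + 1) * (1 - q) ≤ (1 + ε) * ((G - y) * q) := by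
    have hleft : (y + 1) * (1 - q) ≤ G * q * ((1 + 9 * d / 8) * (1 - q)) := by
      have : (y : ℝ) + 1 ≤ G * q * (1 + 9 * d / 8) := by linarith
      have := mul_le_mul_of_nonneg_right this (sub_nonneg.2 hq1.le)
      linarith
    have hmid : (1 + 9 * d / 8) * (1 - q) ≤ (1 + ε) * (1 - (1 + d) * q) := by
      refine le_of_mul_le_mul_right ?_ (sub_pos.2 hd1)
      have hgap : (1 + d) * q ≤ (1 - q) * (7 / 8 + 9 * d / 8) := by nlinarith
      have := mul_le_mul_of_nonneg_left hgap hd0.le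
      linear_combination this - (1 - (1 + d) * q) * hεd
    have hright : G * q * (1 - (1 + d) * q) ≤ (G - y) * q := by
      linarith [mul_le_mul_of_nonneg_right hy2 hq0.le]
    calc (y + 1) * (1 - q) ≤ G * q * ((1 + 9 * d / 8) * (1 - q)) := hleft
      _ ≤ G * q * ((1 + ε) * (1 - (1 + d) * q)) := by gcongr
      _ = (1 + ε) * (G * q * (1 - (1 + d) * q)) := by ring
      _ ≤ (1 + ε) * ((G - y) * q) := by gcongr
  have hG_sub : 0 ≤ (G - y) * q := mul_nonneg (sub_nonneg.2 hyG.le) hq0.le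
  have hy_succ : 0 ≤ ((y : ℝ) + 1) * (1 - q) :=
    mul_nonneg (by positivity) (sub_nonneg.2 hq1.le)
  rw [h₀, h₁, mul_left_comm _ A, mul_left_comm _ A]
  exact ⟨mul_le_mul_of_nonneg_left (hup.trans (by gcongr)) hA,
    mul_le_mul_of_nonneg_left (hdown.trans (by gcongr)) hA⟩
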